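/- Information cost bound for the decay-tracking algorithm: Let 1 ≤ τ ≤ ρ < ∞ with 1/ρ + 1/ρ' = 1/τ, let 0 < b < 1 < a, let λ = (λ_i)_{i∈ℕ} be positive with ‖λ‖_{ρ'} < ∞, let 0 = n₀ < n₁ < n₂ < ⋯ be strictly increasing integers, and let R > 0, ε > 0. Define σ_j(c) and Λ_j blockwise as usual. If j ∈ ℕ satisfies ‖( b^{j+r} Λ_{j+r} )_{r=1}^∞‖_τ ≤ (b ε/(R a²)) · ( (1 − b^{jρ})/(1 − b^ρ) )^{1/ρ}, then every c in the decay-tracking cone with ‖(c_i/λ_i)_{i∈ℕ}‖_ρ ≤ R satisfies a σ_j(c) ‖( b^r Λ_{j+r} )_{r=1}^∞‖_τ ≤ ε (and hence ‖(c_i)_{i>n_j}‖_τ ≤ ε); in particular, the first index j* at which the data-driven bound a σ_{j*}(c) ‖(b^r Λ_{j*+r})_{r≥1}‖_τ falls below ε satisfies j* ≤ j. -/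

import Mathlib

open scoped ENNReal NNReal

/-- The `ℓ^p` norm (valued in `[0,∞]`) of a real sequence `a` restricted to an
index set `K ⊆ ℕ`, for an extended-real exponent `p`. -/
noncomputable def lpNorm (p : ℝ≥0∞) (K : Set ℕ) (a : ℕ → ℝ) : ℝ≥0∞ :=
  if p = ∞ then ⨆ k ∈ K, (‖a k‖₊ : ℝ≥0∞)
  else (∑' k : K, (‖a k‖₊ : ℝ≥0∞) ^ p.toReal) ^ (1 / p.toReal)

/-- `σ_j(c)`: the `ρ`-norm of the normalized coefficients `c_i/λ_i` over the
`j`-th block `K_j = {i | n_{j-1} ≤ i < n_j}` (sequences indexed from `0`). -/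
noncomputable def blockSigma (ρ : ℝ≥0∞) (lam : ℕ → ℝ) (n : ℕ → ℕ) (c : ℕ → ℝ)
    (j : ℕ) : ℝ≥0∞ :=
  lpNorm ρ {i | n (j - 1) ≤ i ∧ i < n j} (fun i => c i / lam i)

/-- `Λ_j`: the `ρ'`-norm of the weights over the `j`-th block. -/
noncomputable def blockLam (ρ' : ℝ≥0∞) (lam : ℕ → ℝ) (n : ℕ → ℕ)
    (j : ℕ) : ℝ≥0∞ :=
  lpNorm ρ' {i | n (j - 1) ≤ i ∧ i < n j} lam

/-- The data-driven error bound used by the decay-tracking algorithm at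
step `j`: `a σ_j(c) ‖(b^r Λ_{j+r})_{r=1}^∞‖_τ`. -/
noncomputable def trackErr (τ ρ ρ' : ℝ≥0∞) (a b : ℝ) (lam : ℕ → ℝ)
    (n : ℕ → ℕ) (c : ℕ → ℝ) (j : ℕ) : ℝ≥0∞ :=
  ENNReal.ofReal a * blockSigma ρ lam n c j *
    (∑' r : ℕ,
        (ENNReal.ofReal (b ^ (r + 1)) * blockLam ρ' lam n (j + r + 1)) ^
          τ.toReal) ^ (1 / τ.toReal)

lemma lpNorm_Ico (p : ℝ≥0∞) (hp : p ≠ ∞) (m k : ℕ) (x : ℕ → ℝ) :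
    lpNorm p {i | m ≤ i ∧ i < k} x =
      (∑ i ∈ Finset.Ico m k, (‖x i‖₊ : ℝ≥0∞) ^ p.toReal) ^ (1 / p.toReal) := by
  have h : {i | m ≤ i ∧ i < k} = ((Finset.Ico m k : Finset ℕ) : Set ℕ) := by
    ext i; simp
  unfold lpNorm
  rw [if_neg hp, h]
  congr 1
  exact Finset.tsum_subtype' (Finset.Ico m k) (fun i => (‖x i‖₊ : ℝ≥0∞) ^ p.toReal)

lemma sum_blocks (n : ℕ → ℕ) (hn0 : n 0 = 0) (hmono : StrictMono n) (f : ℕ → ℝ≥0∞) (j : ℕ) :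
    ∑ k ∈ Finset.range j, ∑ i ∈ Finset.Ico (n k) (n (k + 1)), f i =
      ∑ i ∈ Finset.range (n j), f i := by
  induction j with
  | zero => simp [hn0]
  | succ j ih =>
    rw [Finset.sum_range_succ, ih, Finset.range_eq_Ico, Finset.range_eq_Ico]
    exact Finset.sum_Ico_consecutive f (Nat.zero_le _) (hmono (Nat.lt_succ_self j)).le

lemma block_holder (τ ρ ρ' : ℝ≥0∞) (hτ : 1 ≤ τ) (hτρ : τ ≤ ρ)
    (hρfin : ρ ≠ ∞) (hconj : 1 / ρ + 1 / ρ' = 1 / τ)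
    (lam : ℕ → ℝ) (hpos : ∀ i, 0 < lam i) (c : ℕ → ℝ) (m k : ℕ) :
    ∑ i ∈ Finset.Ico m k, (‖c i‖₊ : ℝ≥0∞) ^ τ.toReal ≤
      (lpNorm ρ {i | m ≤ i ∧ i < k} (fun i => c i / lam i) *
        lpNorm ρ' {i | m ≤ i ∧ i < k} lam) ^ τ.toReal := by
  have hτfin : τ ≠ ∞ := ne_top_of_le_ne_top hρfin hτρ
  have hτ0 : τ ≠ 0 := (zero_lt_one.trans_le hτ).ne'
  have hρ0 : ρ ≠ 0 := (zero_lt_one.trans_le (hτ.trans hτρ)).ne'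
  have ht : 0 < τ.toReal := ENNReal.toReal_pos hτ0 hτfin
  have hr : 0 < ρ.toReal := ENNReal.toReal_pos hρ0 hρfin
  have hsplit : ∀ i, (‖c i‖₊ : ℝ≥0∞) ^ τ.toReal =
      (‖c i / lam i‖₊ : ℝ≥0∞) ^ τ.toReal * (‖lam i‖₊ : ℝ≥0∞) ^ τ.toReal := by
    intro i
    rw [← ENNReal.mul_rpow_of_nonneg _ _ ht.le, ← ENNReal.coe_mul, ← nnnorm_mul,
      div_mul_cancel₀ _ (hpos i).ne']
  rw [ENNReal.mul_rpow_of_nonneg _ _ ht.le, Finset.sum_congr rfl (fun i _ => hsplit i)]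
  have hρ'0 : ρ' ≠ 0 := by
    rintro rfl
    simp at hconj
    exact hτ0 (ENNReal.inv_eq_top.mp hconj.symm)
  by_cases hρ' : ρ' = ∞
  · subst hρ'
    have hρτ : ρ = τ := by simpa using hconj
    subst hρτ
    rw [lpNorm_Ico ρ hρfin, ← ENNReal.rpow_mul, one_div, inv_mul_cancel₀ hr.ne',
      ENNReal.rpow_one, Finset.sum_mul]
    refine Finset.sum_le_sum fun i hi => ?_
    gcongr
    rw [lpNorm, if_pos rfl]
    rw [Finset.mem_Ico] at hi
    exact le_iSup₂_of_le (f := fun k (_ : k ∈ _) => (‖lam k‖₊ : ℝ≥0∞)) i hi le_rfl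
  · have hr' : 0 < ρ'.toReal := ENNReal.toReal_pos hρ'0 hρ'
    have hreal : 1 / ρ.toReal + 1 / ρ'.toReal = 1 / τ.toReal := by
      have := congrArg ENNReal.toReal hconj
      rw [ENNReal.toReal_add (by simpa using hρ0) (by simpa using hρ'0)] at this
      simpa using this
    have hH : (ρ.toReal / τ.toReal).HolderConjugate (ρ'.toReal / τ.toReal) := by
      constructor
      · rw [inv_div, inv_div, inv_one]
        have : τ.toReal / ρ.toReal + τ.toReal / ρ'.toReal =
          τ.toReal * (1 / ρ.toReal + 1 / ρ'.toReal) := by ring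
        rw [this, hreal]; field_simp
      · positivity
      · positivity
    refine (ENNReal.inner_le_Lp_mul_Lq _ _ _ hH).trans (le_of_eq ?_)
    rw [lpNorm_Ico ρ hρfin, lpNorm_Ico ρ' hρ', ← ENNReal.rpow_mul, ← ENNReal.rpow_mul]
    have e1 : ∀ (y : ℝ≥0∞) (q : ℝ), (y ^ τ.toReal) ^ (q / τ.toReal) = y ^ q := by
      intro y q
      rw [← ENNReal.rpow_mul, mul_div_cancel₀ _ ht.ne']
    simp only [e1, one_div_div]
    congr 2 <;> ring

lemma tail_bound (τ ρ ρ' : ℝ≥0∞) (hτ : 1 ≤ τ) (hτρ : τ ≤ ρ)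
    (hρfin : ρ ≠ ∞) (hconj : 1 / ρ + 1 / ρ' = 1 / τ)
    (a b : ℝ) (ha : 1 < a)
    (lam : ℕ → ℝ) (hpos : ∀ i, 0 < lam i)
    (n : ℕ → ℕ) (hmono : StrictMono n)
    (j : ℕ) (hj : 1 ≤ j) (c : ℕ → ℝ)
    (hc : ∀ j' r : ℕ, 1 ≤ j' → 1 ≤ r →
        blockSigma ρ lam n c (j' + r) ≤
          ENNReal.ofReal (a * b ^ r) * blockSigma ρ lam n c j') :
    lpNorm τ {i | n j ≤ i} c ≤ trackErr τ ρ ρ' a b lam n c j := by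
  have hτfin : τ ≠ ∞ := ne_top_of_le_ne_top hρfin hτρ
  have hτ0 : τ ≠ 0 := (zero_lt_one.trans_le hτ).ne'
  have ht : 0 < τ.toReal := ENNReal.toReal_pos hτ0 hτfin
  have hset : {i | n j ≤ i} = ⋃ r : ℕ, ((Finset.Ico (n (j + r)) (n (j + r + 1)) : Finset ℕ) : Set ℕ) := by
    ext i
    simp only [Set.mem_setOf_eq, Set.mem_iUnion, Finset.coe_Ico, Set.mem_Ico]
    constructor
    · intro h
      have hex : ∃ r, i < n (j + r + 1) :=
        ⟨i, lt_of_lt_of_le (by omega : i < j + i + 1) (hmono.id_le (j + i + 1))⟩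
      classical
      refine ⟨Nat.find hex, ?_, Nat.find_spec hex⟩
      rcases hq : Nat.find hex with _ | q
      · simpa using h
      · have := Nat.find_min hex (m := q) (by omega)
        exact not_lt.mp this
    · rintro ⟨r, h1, _⟩
      exact (hmono.monotone (Nat.le_add_right j r)).trans h1
  unfold trackErr lpNorm
  rw [if_neg hτfin]
  have key : ∑' k : {i | n j ≤ i}, (‖c k‖₊ : ℝ≥0∞) ^ τ.toReal ≤
      (ENNReal.ofReal a * blockSigma ρ lam n c j) ^ τ.toReal * ∑' r : ℕ,
        (ENNReal.ofReal (b ^ (r + 1)) * blockLam ρ' lam n (j + r + 1)) ^ τ.toReal := by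
    rw [hset, ← ENNReal.tsum_mul_left]
    refine (ENNReal.tsum_iUnion_le_tsum (fun i => (‖c i‖₊ : ℝ≥0∞) ^ τ.toReal) _).trans ?_
    refine ENNReal.tsum_le_tsum fun r => ?_
    refine (le_of_eq (Finset.tsum_subtype' _ (fun i => (‖c i‖₊ : ℝ≥0∞) ^ τ.toReal))).trans ?_
    refine (block_holder τ ρ ρ' hτ hτρ hρfin hconj lam hpos c _ _).trans ?_
    rw [← ENNReal.mul_rpow_of_nonneg _ _ ht.le]
    refine ENNReal.rpow_le_rpow ?_ ht.le
    have h := hc j (r + 1) hj (by omega)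
    rw [ENNReal.ofReal_mul (by linarith)] at h
    calc _ = blockSigma ρ lam n c (j + (r + 1)) * blockLam ρ' lam n (j + r + 1) := rfl
      _ ≤ (ENNReal.ofReal a * ENNReal.ofReal (b ^ (r + 1)) * blockSigma ρ lam n c j) *
          blockLam ρ' lam n (j + r + 1) := by gcongr
      _ = _ := by ring
  refine (ENNReal.rpow_le_rpow key (by positivity)).trans (le_of_eq ?_)
  rw [ENNReal.mul_rpow_of_nonneg _ _ (by positivity), ← ENNReal.rpow_mul,
    mul_one_div_cancel ht.ne', ENNReal.rpow_one]

lemma sigma_bound (ρ : ℝ≥0∞) (hρ0 : ρ ≠ 0)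
    (hρfin : ρ ≠ ∞)
    (a b : ℝ) (hb0 : 0 < b) (hb1 : b < 1) (ha : 1 < a)
    (lam : ℕ → ℝ)
    (n : ℕ → ℕ) (hn0 : n 0 = 0) (hmono : StrictMono n)
    (R : ℝ) (hR : 0 < R)
    (j : ℕ) (hj : 1 ≤ j) (c : ℕ → ℝ)
    (hc : ∀ j' r : ℕ, 1 ≤ j' → 1 ≤ r →
        blockSigma ρ lam n c (j' + r) ≤
          ENNReal.ofReal (a * b ^ r) * blockSigma ρ lam n c j')
    (hcR : lpNorm ρ Set.univ (fun i => c i / lam i) ≤ ENNReal.ofReal R) :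
    blockSigma ρ lam n c j * ENNReal.ofReal (b *
      ((1 - b ^ (ρ.toReal * (j : ℝ))) / (1 - b ^ ρ.toReal)) ^ (1 / ρ.toReal)) ≤
      ENNReal.ofReal (a * b ^ j * R) := by
  have hr : 0 < ρ.toReal := ENNReal.toReal_pos hρ0 hρfin
  set p := ρ.toReal with hp
  have hbp1 : b ^ p < 1 := Real.rpow_lt_one hb0.le hb1 hr
  have hbp0 : 0 < b ^ p := Real.rpow_pos_of_pos hb0 p
  have hpow : ∀ m, blockSigma ρ lam n c (m + 1) ^ p =
      ∑ i ∈ Finset.Ico (n m) (n (m + 1)), (‖c i / lam i‖₊ : ℝ≥0∞) ^ p := by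
    intro m
    unfold blockSigma
    rw [lpNorm_Ico ρ hρfin, ← ENNReal.rpow_mul, ← hp, one_div, inv_mul_cancel₀ hr.ne',
      ENNReal.rpow_one]
    simp
  have hsum : ∑ k ∈ Finset.range j, blockSigma ρ lam n c (k + 1) ^ p ≤ ENNReal.ofReal R ^ p := by
    simp only [hpow]
    rw [sum_blocks n hn0 hmono]
    refine le_trans ?_ (ENNReal.rpow_le_rpow hcR hr.le)
    unfold lpNorm
    rw [if_neg hρfin, ← ENNReal.rpow_mul, ← hp, one_div, inv_mul_cancel₀ hr.ne',
      ENNReal.rpow_one, tsum_univ (fun i => (‖c i / lam i‖₊ : ℝ≥0∞) ^ p)]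
    exact ENNReal.sum_le_tsum _
  have hstep : ∀ k ∈ Finset.range j, blockSigma ρ lam n c j * ENNReal.ofReal (b ^ (k + 1)) ≤
      ENNReal.ofReal (a * b ^ j) * blockSigma ρ lam n c (k + 1) := by
    intro k hk
    rw [Finset.mem_range] at hk
    rcases Nat.eq_or_lt_of_le (Nat.succ_le_of_lt hk) with h | h
    · have h' : k + 1 = j := h
      rw [h', mul_comm]
      gcongr
      have := pow_pos hb0 j
      nlinarith
    · obtain ⟨r, rfl⟩ := Nat.exists_eq_add_of_lt h
      have := hc (k + 1) (r + 1) (by omega) (by omega)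
      have e : k.succ + r + 1 = k + 1 + (r + 1) := by omega
      rw [e]
      calc _ ≤ (ENNReal.ofReal (a * b ^ (r + 1)) * blockSigma ρ lam n c (k + 1)) *
            ENNReal.ofReal (b ^ (k + 1)) := by gcongr
        _ = (ENNReal.ofReal (a * b ^ (r + 1)) * ENNReal.ofReal (b ^ (k + 1))) *
            blockSigma ρ lam n c (k + 1) := by ring
        _ = _ := by
          rw [← ENNReal.ofReal_mul (by positivity)]
          congr 2
          ring
  have hgeo : ∑ k ∈ Finset.range j, ENNReal.ofReal (b ^ (k + 1)) ^ p =
      ENNReal.ofReal (b ^ p * ((1 - b ^ (p * (j : ℝ))) / (1 - b ^ p))) := by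
    have : ∀ k, ENNReal.ofReal (b ^ (k + 1)) ^ p = ENNReal.ofReal (b ^ p * (b ^ p) ^ k) := by
      intro k
      rw [ENNReal.ofReal_rpow_of_nonneg (by positivity) hr.le]
      congr 1
      rw [← pow_succ', ← Real.rpow_natCast, ← Real.rpow_natCast, ← Real.rpow_mul hb0.le,
        ← Real.rpow_mul hb0.le, mul_comm]
    simp only [this]
    rw [← ENNReal.ofReal_sum_of_nonneg (fun k _ => by positivity), ← Finset.mul_sum,
      geom_sum_eq hbp1.ne, Real.rpow_mul hb0.le, Real.rpow_natCast]
    congr 2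
    rw [← neg_div_neg_eq]; ring
  have hG0 : 0 ≤ (1 - b ^ (p * (j : ℝ))) / (1 - b ^ p) := by
    apply div_nonneg _ (by linarith)
    have := Real.rpow_le_one hb0.le hb1.le (by positivity : 0 ≤ p * (j : ℝ))
    linarith
  have hroot : (ENNReal.ofReal (b ^ p * ((1 - b ^ (p * (j : ℝ))) / (1 - b ^ p)))) ^ (1 / p) =
      ENNReal.ofReal (b * ((1 - b ^ (p * (j : ℝ))) / (1 - b ^ p)) ^ (1 / p)) := by
    rw [ENNReal.ofReal_rpow_of_nonneg (by positivity) (by positivity),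
      Real.mul_rpow hbp0.le hG0, ← Real.rpow_mul hb0.le, mul_one_div_cancel hr.ne', Real.rpow_one]
  rw [← hroot, ← hgeo]
  rw [← ENNReal.rpow_le_rpow_iff hr, ENNReal.mul_rpow_of_nonneg _ _ hr.le, ← ENNReal.rpow_mul,
    one_div, inv_mul_cancel₀ hr.ne', ENNReal.rpow_one, Finset.mul_sum,
    ENNReal.ofReal_mul (by positivity), ENNReal.mul_rpow_of_nonneg _ _ hr.le]
  calc _ ≤ ∑ k ∈ Finset.range j,
        ENNReal.ofReal (a * b ^ j) ^ p * blockSigma ρ lam n c (k + 1) ^ p := by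
        refine Finset.sum_le_sum fun k hk => ?_
        rw [← ENNReal.mul_rpow_of_nonneg _ _ hr.le, ← ENNReal.mul_rpow_of_nonneg _ _ hr.le]
        exact ENNReal.rpow_le_rpow (hstep k hk) hr.le
    _ ≤ _ := by
        rw [← Finset.mul_sum]
        gcongr

/-- Information-cost bound for the decay-tracking algorithm: if `j ≥ 1`
satisfies `‖(b^{j+r} Λ_{j+r})_{r=1}^∞‖_τ ≤ (bε/(Ra²))((1−b^{jρ})/(1−b^ρ))^{1/ρ}`,
then every `c` in the decay-tracking cone with `‖(c_i/λ_i)‖_ρ ≤ R` satisfies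
`a σ_j(c) ‖(b^r Λ_{j+r})_{r≥1}‖_τ ≤ ε` (hence `‖(c_i)_{i≥n_j}‖_τ ≤ ε`), and in
particular the first step `j*` at which the data-driven bound falls below `ε`
satisfies `j* ≤ j`. -/
theorem decay_tracking_cost_bound (τ ρ ρ' : ℝ≥0∞) (hτ : 1 ≤ τ) (hτρ : τ ≤ ρ)
    (hρfin : ρ ≠ ∞) (hconj : 1 / ρ + 1 / ρ' = 1 / τ)
    (a b : ℝ) (hb0 : 0 < b) (hb1 : b < 1) (ha : 1 < a)
    (lam : ℕ → ℝ) (hpos : ∀ i, 0 < lam i)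
    (hΛfin : lpNorm ρ' Set.univ lam ≠ ∞)
    (n : ℕ → ℕ) (hn0 : n 0 = 0) (hmono : StrictMono n)
    (R ε : ℝ) (hR : 0 < R) (hε : 0 < ε)
    (j : ℕ) (hj : 1 ≤ j)
    (hjbound : (∑' r : ℕ,
          (ENNReal.ofReal (b ^ (j + r + 1)) * blockLam ρ' lam n (j + r + 1)) ^
            τ.toReal) ^ (1 / τ.toReal) ≤
        ENNReal.ofReal (b * ε / (R * a ^ 2) *
          ((1 - b ^ (ρ.toReal * (j : ℝ))) / (1 - b ^ ρ.toReal)) ^ (1 / ρ.toReal))) :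
    ∀ c : ℕ → ℝ,
      (∀ j' r : ℕ, 1 ≤ j' → 1 ≤ r →
        blockSigma ρ lam n c (j' + r) ≤
          ENNReal.ofReal (a * b ^ r) * blockSigma ρ lam n c j') →
      lpNorm ρ Set.univ (fun i => c i / lam i) ≤ ENNReal.ofReal R →
      trackErr τ ρ ρ' a b lam n c j ≤ ENNReal.ofReal ε ∧
        lpNorm τ {i | n j ≤ i} c ≤ ENNReal.ofReal ε ∧
        sInf {j' : ℕ | 1 ≤ j' ∧ trackErr τ ρ ρ' a b lam n c j' ≤ ENNReal.ofReal ε}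
          ≤ j := by
  intro c hc hcR
  have hτfin : τ ≠ ∞ := ne_top_of_le_ne_top hρfin hτρ
  have hτ0 : τ ≠ 0 := (zero_lt_one.trans_le hτ).ne'
  have hρ0 : ρ ≠ 0 := (zero_lt_one.trans_le (hτ.trans hτρ)).ne'
  have ht : 0 < τ.toReal := ENNReal.toReal_pos hτ0 hτfin
  have hS := sigma_bound ρ hρ0 hρfin a b hb0 hb1 ha lam n hn0 hmono R hR j hj c hc hcR
  have main : trackErr τ ρ ρ' a b lam n c j ≤ ENNReal.ofReal ε := by
    unfold trackErr
    set T := (∑' r : ℕ,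
        (ENNReal.ofReal (b ^ (r + 1)) * blockLam ρ' lam n (j + r + 1)) ^
          τ.toReal) ^ (1 / τ.toReal) with hT
    set s := blockSigma ρ lam n c j
    set G := ((1 - b ^ (ρ.toReal * (j : ℝ))) / (1 - b ^ ρ.toReal)) ^ (1 / ρ.toReal)
    have hfac : (∑' r : ℕ,
          (ENNReal.ofReal (b ^ (j + r + 1)) * blockLam ρ' lam n (j + r + 1)) ^
            τ.toReal) ^ (1 / τ.toReal) = ENNReal.ofReal (b ^ j) * T := by
      have : ∀ r : ℕ, (ENNReal.ofReal (b ^ (j + r + 1)) * blockLam ρ' lam n (j + r + 1)) ^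
            τ.toReal = ENNReal.ofReal (b ^ j) ^ τ.toReal *
            (ENNReal.ofReal (b ^ (r + 1)) * blockLam ρ' lam n (j + r + 1)) ^ τ.toReal := by
        intro r
        rw [← ENNReal.mul_rpow_of_nonneg _ _ ht.le, ← mul_assoc,
          ← ENNReal.ofReal_mul (by positivity), ← pow_add, add_assoc]
      simp only [this]
      rw [ENNReal.tsum_mul_left, ENNReal.mul_rpow_of_nonneg _ _ (by positivity),
        ← ENNReal.rpow_mul, mul_one_div_cancel ht.ne', ENNReal.rpow_one]
    rw [hfac] at hjbound
    have hK : 0 < a * b ^ j * R := by positivity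
    have hK0 : ENNReal.ofReal (a * b ^ j * R) ≠ 0 := by
      simpa using hK
    rw [← ENNReal.mul_le_mul_iff_right hK0 ENNReal.ofReal_ne_top]
    have e1 : ENNReal.ofReal (a * b ^ j * R) =
        ENNReal.ofReal (a * R) * ENNReal.ofReal (b ^ j) := by
      rw [← ENNReal.ofReal_mul (by positivity)]; congr 1; ring
    have e2 : ENNReal.ofReal (a * R) * ENNReal.ofReal a * ENNReal.ofReal (b * ε / (R * a ^ 2) * G)
        = ENNReal.ofReal ε * ENNReal.ofReal (b * G) := by
      rw [← ENNReal.ofReal_mul (by positivity), ← ENNReal.ofReal_mul (by positivity),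
        ← ENNReal.ofReal_mul (by positivity)]
      congr 1
      field_simp
    calc ENNReal.ofReal (a * b ^ j * R) * (ENNReal.ofReal a * s * T)
        = ENNReal.ofReal (a * R) * ENNReal.ofReal a * (ENNReal.ofReal (b ^ j) * T) * s := by
          rw [e1]; ring
      _ ≤ ENNReal.ofReal (a * R) * ENNReal.ofReal a *
          ENNReal.ofReal (b * ε / (R * a ^ 2) * G) * s := by gcongr
      _ = ENNReal.ofReal ε * (s * ENNReal.ofReal (b * G)) := by rw [e2]; ring
      _ ≤ ENNReal.ofReal ε * ENNReal.ofReal (a * b ^ j * R) := by gcongr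
      _ = _ := mul_comm _ _
  exact ⟨main, (tail_bound τ ρ ρ' hτ hτρ hρfin hconj a b ha lam hpos n hmono j hj c hc).trans main,
    Nat.sInf_le ⟨hj, main⟩⟩
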